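/- arXiv:2301.09293 — 7 statements merged into one kernel-verified Lean document; each statement's English description precedes it below -/
import Mathlib

section
/- Let g ≥ 1, n ≥ 1, 0 ≤ r ≤ g, and let a_1, …, a_r be nonzero elements of ℤ/n. Let ω : ℤ^{2g} × ℤ^{2g} → ℤ/n be the alternating ℤ-bilinear form determined on the standard basis e_1, …, e_{2g} of ℤ^{2g} by ω(e_i, e_{i+g}) = a_i and ω(e_{i+g}, e_i) = −a_i for 1 ≤ i ≤ r, and ω(e_i, e_j) = 0 for all other pairs i ≠ j. Then the minimum of the index [ℤ^{2g} : L], taken over all finite-index subgroups L ≤ ℤ^{2g} such that ω(x, y) = 0 for all x, y ∈ L, equals ∏_{i=1}^r Ann_ℤ(a_i). -/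
/-- The index `i` viewed in `Fin (2*g)` (the basis vector `e_i`). -/
def idxL {g r : ℕ} (hr : r ≤ g) (i : Fin r) : Fin (2 * g) :=
  ⟨i.1, by have := i.2; omega⟩

/-- The index `i + g` viewed in `Fin (2*g)` (the basis vector `e_{i+g}`). -/
def idxH {g r : ℕ} (hr : r ≤ g) (i : Fin r) : Fin (2 * g) :=
  ⟨i.1 + g, by have := i.2; omega⟩

/-- The alternating `ℤ/n`-valued bilinear form on `ℤ^{2g}` determined by
`ω(e_i, e_{i+g}) = a_i`, `ω(e_{i+g}, e_i) = -a_i` for `1 ≤ i ≤ r`, and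
`ω(e_i, e_j) = 0` for all other pairs `i ≠ j`. -/
def omegaForm {g r n : ℕ} (hr : r ≤ g) (a : Fin r → ZMod n)
    (x y : Fin (2 * g) → ℤ) : ZMod n :=
  ∑ i : Fin r, a i *
    ((x (idxL hr i) * y (idxH hr i) - x (idxH hr i) * y (idxL hr i) : ℤ) : ZMod n)

/-- A finite abelian group has at most as many homomorphisms to `ZMod n` as elements. -/
theorem natCard_addMonoidHom_zmod_le {G : Type*} [AddCommGroup G] [Finite G] (n : ℕ) [NeZero n] :
    Nat.card (G →+ ZMod n) ≤ Nat.card G := by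
  have := Fintype.ofFinite G
  let F : (G →+ ZMod n) → AddChar G ℂ := fun f ↦
    Circle.coeHom.compAddChar (ZMod.toCircle.compAddMonoidHom f)
  have hF : Function.Injective F := by
    intro f g h
    ext x
    exact ZMod.injective_toCircle (Circle.coe_injective (DFunLike.congr_fun h x))
  calc Nat.card (G →+ ZMod n) ≤ Nat.card (AddChar G ℂ) := Nat.card_le_card_of_injective F hF
    _ ≤ Nat.card G := by
      rw [Nat.card_eq_fintype_card, Nat.card_eq_fintype_card]
      exact AddChar.card_addChar_le G ℂ

/-- A subgroup containing the radical of a `ZMod n`-valued pairing has index at most the square of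
the index of any finite-index isotropic subgroup. -/
theorem index_le_sq_index_of_isotropic {A : Type*} [AddCommGroup A] {n : ℕ} [NeZero n]
    (B : A →+ A →+ ZMod n) {K L : AddSubgroup A} (hK : B.ker ≤ K) (hL : L.index ≠ 0)
    (hB : ∀ x ∈ L, ∀ y ∈ L, B x y = 0) : K.index ≤ L.index ^ 2 := by
  have : L.FiniteIndex := ⟨hL⟩
  let f : L →+ (A ⧸ L →+ ZMod n) := AddMonoidHom.mk'
    (fun x ↦ QuotientAddGroup.lift L (B x) fun y hy ↦ hB x x.2 y hy) fun x y ↦ by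
      ext z
      exact DFunLike.congr_fun (map_add B (x : A) y) z
  have hker : f.ker = B.ker.addSubgroupOf L := by
    ext x
    rw [AddMonoidHom.mem_ker, AddSubgroup.mem_addSubgroupOf, AddMonoidHom.mem_ker]
    refine ⟨fun h ↦ ?_, fun h ↦ ?_⟩
    · ext y
      exact DFunLike.congr_fun h (y : A ⧸ L)
    · ext y
      exact DFunLike.congr_fun h y
  have : Finite (A ⧸ L →+ ZMod n) := DFunLike.finite _
  have hrel : B.ker.relIndex L = Nat.card f.range := by
    rw [AddSubgroup.relIndex, ← hker, AddSubgroup.index_ker]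
  have hle : B.ker.relIndex L ≤ L.index := by
    rw [hrel]
    exact (Nat.card_le_card_of_injective _ Subtype.val_injective).trans
      (natCard_addMonoidHom_zmod_le n)
  have hne : B.ker.relIndex L ≠ 0 := by
    rw [hrel]
    exact Nat.card_pos.ne'
  have hmul : B.ker.relIndex L * L.index = (B.ker ⊓ L).index := by
    rw [← AddSubgroup.inf_relIndex_right, AddSubgroup.relIndex_mul_index inf_le_right]
  calc K.index ≤ (B.ker ⊓ L).index :=
        Nat.le_of_dvd (Nat.pos_of_ne_zero (hmul ▸ mul_ne_zero hne hL))
          (AddSubgroup.index_dvd_of_le (inf_le_left.trans hK))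
    _ = B.ker.relIndex L * L.index := hmul.symm
    _ ≤ L.index ^ 2 := by
        rw [sq]
        exact Nat.mul_le_mul_right _ hle

/-- Reduction of the coordinates `x (s j)` modulo `m j`. -/
def reduceCoords {ι κ : Type*} (s : κ → ι) (m : κ → ℕ) : (ι → ℤ) →+ ∀ j, ZMod (m j) where
  toFun x j := (x (s j) : ZMod (m j))
  map_zero' := by
    ext
    simp
  map_add' x y := by
    ext
    simp

theorem mem_ker_reduceCoords {ι κ : Type*} {s : κ → ι} {m : κ → ℕ} {x : ι → ℤ} :
    x ∈ (reduceCoords s m).ker ↔ ∀ j, (m j : ℤ) ∣ x (s j) := by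
  simp [AddMonoidHom.mem_ker, funext_iff, reduceCoords, ZMod.intCast_zmod_eq_zero_iff_dvd]

theorem index_ker_reduceCoords {ι κ : Type*} [Fintype κ] {s : κ → ι}
    (hs : Function.Injective s) (m : κ → ℕ) :
    (reduceCoords s m).ker.index = ∏ j, m j := by
  have hsurj : Function.Surjective (reduceCoords s m) := by
    intro z
    choose w hw using fun j ↦ ZMod.intCast_surjective (z j)
    refine ⟨Function.extend s w 0, funext fun j ↦ ?_⟩
    change ((Function.extend s w 0 (s j) : ℤ) : ZMod (m j)) = z j
    rw [hs.extend_apply, hw]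
  rw [AddSubgroup.index_ker, AddMonoidHom.range_eq_top.mpr hsurj, AddSubgroup.card_top,
    Nat.card_pi]
  simp

theorem idxL_injective {g r : ℕ} (hr : r ≤ g) : Function.Injective (idxL hr) := by
  intro i j h
  simpa [idxL, Fin.ext_iff] using h

theorem idxH_injective {g r : ℕ} (hr : r ≤ g) : Function.Injective (idxH hr) := by
  intro i j h
  simpa [idxH, Fin.ext_iff] using h

theorem idxL_ne_idxH {g r : ℕ} (hr : r ≤ g) (i j : Fin r) : idxL hr i ≠ idxH hr j := by
  simp only [idxL, idxH, ne_eq, Fin.mk.injEq]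
  omega

/-- `omegaForm` as a biadditive map. -/
def omegaHom {g r n : ℕ} (hr : r ≤ g) (a : Fin r → ZMod n) :
    (Fin (2 * g) → ℤ) →+ (Fin (2 * g) → ℤ) →+ ZMod n :=
  AddMonoidHom.mk' (fun x ↦ AddMonoidHom.mk' (omegaForm hr a x) fun y z ↦ by
    simp only [omegaForm, ← Finset.sum_add_distrib]
    refine Finset.sum_congr rfl fun i _ ↦ ?_
    push_cast [Pi.add_apply]
    ring) fun x y ↦ by
    refine AddMonoidHom.ext fun z ↦ ?_
    simp only [AddMonoidHom.mk'_apply, AddMonoidHom.add_apply, omegaForm,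
      ← Finset.sum_add_distrib]
    refine Finset.sum_congr rfl fun i _ ↦ ?_
    push_cast [Pi.add_apply]
    ring

theorem omegaForm_single_idxH {g r n : ℕ} (hr : r ≤ g) (a : Fin r → ZMod n)
    (x : Fin (2 * g) → ℤ) (i : Fin r) :
    omegaForm hr a x (Pi.single (idxH hr i) 1) = x (idxL hr i) • a i := by
  rw [omegaForm, Finset.sum_eq_single i]
  · simp [idxL_ne_idxH, mul_comm]
  · intro j _ hj
    simp [idxL_ne_idxH, (idxH_injective hr).ne hj]
  · simp

theorem omegaForm_single_idxL {g r n : ℕ} (hr : r ≤ g) (a : Fin r → ZMod n)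
    (x : Fin (2 * g) → ℤ) (i : Fin r) :
    omegaForm hr a x (Pi.single (idxL hr i) 1) = -(x (idxH hr i) • a i) := by
  rw [omegaForm, Finset.sum_eq_single i]
  · simp [(idxL_ne_idxH hr _ _).symm, mul_comm]
  · intro j _ hj
    simp [(idxL_ne_idxH hr _ _).symm, (idxL_injective hr).ne hj]
  · simp

/-- The radical of `omegaForm` is contained in the subgroup of vectors whose `i`-th and `(i + g)`-th coordinates
are divisible by the order of `a i`. -/
theorem ker_omegaHom_le {g r n : ℕ} (hr : r ≤ g) (a : Fin r → ZMod n) :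
    (omegaHom hr a).ker ≤ (reduceCoords (Sum.elim (idxL hr) (idxH hr))
      (Sum.elim (fun i ↦ addOrderOf (a i)) fun i ↦ addOrderOf (a i))).ker := by
  intro x hx
  have hx' (y : Fin (2 * g) → ℤ) : omegaForm hr a x y = 0 := DFunLike.congr_fun hx y
  rw [mem_ker_reduceCoords]
  rintro (i | i)
  · exact addOrderOf_dvd_iff_zsmul_eq_zero.mpr
      ((omegaForm_single_idxH hr a x i).symm.trans (hx' _))
  · exact addOrderOf_dvd_iff_zsmul_eq_zero.mpr
      (neg_eq_zero.mp ((omegaForm_single_idxL hr a x i).symm.trans (hx' _)))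

theorem omegaForm_eq_zero_of_dvd {g r n : ℕ} (hr : r ≤ g) (a : Fin r → ZMod n)
    {x y : Fin (2 * g) → ℤ} (hx : ∀ i, (addOrderOf (a i) : ℤ) ∣ x (idxL hr i))
    (hy : ∀ i, (addOrderOf (a i) : ℤ) ∣ y (idxL hr i)) : omegaForm hr a x y = 0 := by
  refine Finset.sum_eq_zero fun i _ ↦ ?_
  rw [mul_comm, ← zsmul_eq_mul, ← addOrderOf_dvd_iff_zsmul_eq_zero]
  exact dvd_sub ((hx i).mul_right _) ((hy i).mul_left _)

theorem annihilator_eq_prod_addOrderOf (g n r : ℕ) (hg : 1 ≤ g) (hn : 1 ≤ n)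
    (hr : r ≤ g) (a : Fin r → ZMod n) (ha : ∀ i, a i ≠ 0) :
    IsLeast {d : ℕ | 0 < d ∧ ∃ L : AddSubgroup (Fin (2 * g) → ℤ),
        L.index = d ∧ ∀ x ∈ L, ∀ y ∈ L, omegaForm hr a x y = 0}
      (∏ i : Fin r, addOrderOf (a i)) := by
  have : NeZero n := ⟨by omega⟩
  refine ⟨⟨Finset.prod_pos fun i _ ↦ addOrderOf_pos (a i),
    (reduceCoords (idxL hr) fun i ↦ addOrderOf (a i)).ker,
    index_ker_reduceCoords (idxL_injective hr) _, fun x hx y hy ↦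
      omegaForm_eq_zero_of_dvd hr a (mem_ker_reduceCoords.mp hx) (mem_ker_reduceCoords.mp hy)⟩, ?_⟩
  rintro d ⟨hd, L, rfl, hL⟩
  have hle := index_le_sq_index_of_isotropic (omegaHom hr a) (ker_omegaHom_le hr a) hd.ne' hL
  rw [index_ker_reduceCoords
    ((idxL_injective hr).sumElim (idxH_injective hr) (idxL_ne_idxH hr)),
    Fintype.prod_sum_type] at hle
  simp only [Sum.elim_inl, Sum.elim_inr, ← sq] at hle
  exact (Nat.pow_le_pow_iff_left two_ne_zero).mp hle
end

section
/- Let g ≥ 1, n ≥ 1, 0 ≤ r ≤ g, and let a_1, …, a_r be elements of ℤ/n. Let ω : ℤ^{2g} × ℤ^{2g} → ℤ/n be the alternating ℤ-bilinear form determined on the standard basis e_1, …, e_{2g} by ω(e_i, e_{i+g}) = a_i and ω(e_{i+g}, e_i) = −a_i for 1 ≤ i ≤ r, and ω(e_i, e_j) = 0 for all other pairs i ≠ j. Then there exists a subgroup L ≤ ℤ^{2g} of finite index equal to ∏_{i=1}^r Ann_ℤ(a_i) such that ω(x, y) = 0 for all x, y ∈ L; namely, the subgroup generated by Ann_ℤ(a_i)·e_i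 for 1 ≤ i ≤ r together with e_j for all other j. -/
/-- The generating set: `Ann_ℤ(a_i) • e_i` for indices `i < r`, and `e_j` for all
other indices `j`. -/
def annGens {g r n : ℕ} (a : Fin r → ZMod n) : Set (Fin (2 * g) → ℤ) :=
  Set.range fun j : Fin (2 * g) =>
    (if h : j.1 < r then (addOrderOf (a ⟨j.1, h⟩) : ℤ) else 1) • Pi.single j (1 : ℤ)

/-- The coefficient of `e_j` in the generating set `annGens a`. -/
noncomputable def annCoeff {g r n : ℕ} (a : Fin r → ZMod n) (j : Fin (2 * g)) : ℤ :=
  if h : j.1 < r then (addOrderOf (a ⟨j.1, h⟩) : ℤ) else 1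

theorem annCoeff_idxL {g r n : ℕ} (hr : r ≤ g) (a : Fin r → ZMod n) (i : Fin r) :
    annCoeff a (idxL hr i) = addOrderOf (a i) :=
  dif_pos i.2

theorem closure_range_smul_single {ι : Type*} [Fintype ι] [DecidableEq ι] (d : ι → ℤ) :
    AddSubgroup.closure (Set.range fun j => d j • (Pi.single j 1 : ι → ℤ)) =
      AddSubgroup.pi Set.univ fun j => AddSubgroup.zmultiples (d j) := by
  apply le_antisymm
  · rw [AddSubgroup.closure_le]
    rintro _ ⟨j, rfl⟩ k -
    rcases eq_or_ne k j with rfl | hkj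
    · simp
    · simp [hkj]
  · intro x hx
    have hx' : ∀ j, ∃ c : ℤ, c • d j = x j := fun j =>
      AddSubgroup.mem_zmultiples_iff.mp (hx j (Set.mem_univ j))
    choose c hc using hx'
    have hsum : x = ∑ j, c j • (d j • (Pi.single j 1 : ι → ℤ)) := by
      ext k
      simp [Finset.sum_apply, Pi.single_apply, ← hc]
    rw [hsum]
    exact sum_mem fun j _ => zsmul_mem (AddSubgroup.subset_closure (Set.mem_range_self j)) _

theorem closure_annGens {g r n : ℕ} (a : Fin r → ZMod n) :
    AddSubgroup.closure (annGens (g := g) a) =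
      AddSubgroup.pi Set.univ fun j => AddSubgroup.zmultiples (annCoeff a j) :=
  closure_range_smul_single _

theorem mul_intCast_eq_zero_of_mem_zmultiples {n : ℕ} {a : ZMod n} {k : ℤ}
    (hk : k ∈ AddSubgroup.zmultiples (addOrderOf a : ℤ)) : a * (k : ZMod n) = 0 := by
  rw [mul_comm, ← zsmul_eq_mul]
  exact addOrderOf_dvd_iff_zsmul_eq_zero.mp (Int.mem_zmultiples_iff.mp hk)

theorem annihilator_upper_bound (g n r : ℕ) (hg : 1 ≤ g) (hn : 1 ≤ n)
    (hr : r ≤ g) (a : Fin r → ZMod n) :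
    (AddSubgroup.closure (annGens (g := g) a)).index = ∏ i : Fin r, addOrderOf (a i) ∧
      ∀ x ∈ AddSubgroup.closure (annGens (g := g) a),
        ∀ y ∈ AddSubgroup.closure (annGens (g := g) a), omegaForm hr a x y = 0 := by
  rw [closure_annGens]
  constructor
  · rw [AddSubgroup.index_pi]
    simp only [Int.index_zmultiples]
    symm
    apply Fintype.prod_of_injective (idxL hr)
    · intro i j hij
      simpa [idxL, Fin.ext_iff] using hij
    · intro j hj
      have hjr : ¬ j.1 < r := fun h => hj ⟨⟨j.1, h⟩, rfl⟩
      simp [annCoeff, hjr]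
    · intro i
      simp [annCoeff_idxL]
  · intro x hx y hy
    refine Finset.sum_eq_zero fun i _ => mul_intCast_eq_zero_of_mem_zmultiples ?_
    have hxi := Int.mem_zmultiples_iff.mp (hx (idxL hr i) (Set.mem_univ _))
    have hyi := Int.mem_zmultiples_iff.mp (hy (idxL hr i) (Set.mem_univ _))
    rw [annCoeff_idxL] at hxi hyi
    exact Int.mem_zmultiples_iff.mpr (dvd_sub (hxi.mul_right _) (hyi.mul_left _))
end

section
/- Let R be a commutative ring, let g ≥ 1 and 0 ≤ r ≤ g, and let e_1, …, e_{2g} denote the images in the exterior algebra Λ(R^{2g}) of the standard basis of the free module R^{2g}. For elements a_1, …, a_r ∈ R, set η = ∑_{i=1}^r a_i · (e_i ∧ e_{i+g}). Then η^r = r! · (∏_{i=1}^r a_i) · e_1 ∧ e_{1+g} ∧ e_2 ∧ e_{2+g} ∧ ⋯ ∧ e_r ∧ e_{r+g} in Λ(R^{2g}). -/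
/-- The image in the exterior algebra `Λ(R^{2g})` of the `j`-th standard basis
vector of `R^{2g}`. -/
noncomputable def eBasis (R : Type*) [CommRing R] (g : ℕ) (j : Fin (2 * g)) :
    ExteriorAlgebra R (Fin (2 * g) → R) :=
  ExteriorAlgebra.ι R (Pi.single j 1)

theorem Commute.add_pow_succ_of_mul_self_eq_zero {A : Type*} [Semiring A] {x y : A}
    (h : Commute x y) (hx : x * x = 0) (n : ℕ) :
    (x + y) ^ (n + 1) = y ^ (n + 1) + (n + 1) • (x * y ^ n) := by
  induction n with
  | zero => simp [add_comm]
  | succ n ih =>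
    have hxy : x * y ^ n * x = 0 := by
      rw [mul_assoc, ← (h.pow_right n).eq, ← mul_assoc, hx, zero_mul]
    rw [pow_succ, ih, add_mul, mul_add, mul_add, smul_mul_assoc, hxy, smul_mul_assoc,
      mul_assoc x, ← pow_succ, ← pow_succ, ← (h.pow_right (n + 1)).eq, smul_zero, zero_add,
      succ_nsmul _ (n + 1)]
    abel

theorem List.sum_pow_of_commute_of_mul_self_eq_zero {A : Type*} [Semiring A] (l : List A)
    (hc : ∀ x ∈ l, ∀ y ∈ l, Commute x y) (hz : ∀ x ∈ l, x * x = 0) :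
    l.sum ^ l.length = l.length.factorial • l.prod ∧ l.sum ^ (l.length + 1) = 0 := by
  induction l with
  | nil => simp
  | cons x l ih =>
    obtain ⟨ih₁, ih₂⟩ := ih
      (fun y hy z hz => hc y (List.mem_cons_of_mem _ hy) z (List.mem_cons_of_mem _ hz))
      (fun y hy => hz y (List.mem_cons_of_mem _ hy))
    have h : Commute x l.sum := Commute.list_sum_right x l fun y hy =>
      hc x List.mem_cons_self y (List.mem_cons_of_mem _ hy)
    have hx := hz x List.mem_cons_self
    rw [List.sum_cons, List.length_cons, h.add_pow_succ_of_mul_self_eq_zero hx,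
      h.add_pow_succ_of_mul_self_eq_zero hx, ih₂, ih₁, pow_succ _ (l.length + 1), ih₂]
    refine ⟨?_, by simp⟩
    rw [zero_add, mul_smul_comm, smul_smul, List.prod_cons, Nat.factorial_succ]

theorem List.prod_map_smul_algebra {R A ι : Type*} [CommSemiring R] [Semiring A] [Algebra R A]
    (l : List ι) (a : ι → R) (f : ι → A) :
    (l.map fun i => a i • f i).prod = (l.map a).prod • (l.map f).prod := by
  induction l with
  | nil => simp
  | cons i l ih => simp [ih, smul_smul, mul_comm (a i)]

namespace ExteriorAlgebra

variable {R M : Type*} [CommRing R] [AddCommGroup M] [Module R M]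

theorem ι_mul_ι_swap (u v : M) : ι R u * ι R v = -(ι R v * ι R u) :=
  eq_neg_of_add_eq_zero_left (ι_add_mul_swap u v)

theorem commute_ι_mul_ι_ι (u v w : M) : Commute (ι R u * ι R v) (ι R w) := by
  rw [commute_iff_eq, mul_assoc, ι_mul_ι_swap v w, mul_neg, ← mul_assoc, ι_mul_ι_swap u w,
    neg_mul, neg_neg, mul_assoc]

theorem ι_mul_ι_mul_self (u v : M) : (ι R u * ι R v) * (ι R u * ι R v) = 0 := by
  rw [← mul_assoc, (commute_ι_mul_ι_ι u v u).eq, ← mul_assoc, ι_sq_zero, zero_mul, zero_mul]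

end ExteriorAlgebra

theorem eta_pow_r (R : Type*) [CommRing R] (g r : ℕ) (hg : 1 ≤ g) (hr : r ≤ g)
    (a : Fin r → R) :
    (∑ i : Fin r, a i • (eBasis R g (idxL hr i) * eBasis R g (idxH hr i))) ^ r =
      ((r.factorial : R) * ∏ i : Fin r, a i) •
        ((List.finRange r).map fun i =>
          eBasis R g (idxL hr i) * eBasis R g (idxH hr i)).prod := by
  have key := (List.sum_pow_of_commute_of_mul_self_eq_zero ((List.finRange r).map fun i =>
    a i • (eBasis R g (idxL hr i) * eBasis R g (idxH hr i))) ?_ ?_).1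
  · rw [List.length_map, List.length_finRange, List.prod_map_smul_algebra] at key
    rw [← List.ofFn_eq_map, List.sum_ofFn, ← List.ofFn_eq_map, List.prod_ofFn] at key
    rw [key, mul_smul, Nat.cast_smul_eq_nsmul]
  · simp only [List.mem_map]
    rintro _ ⟨i, -, rfl⟩ _ ⟨j, -, rfl⟩
    exact (((ExteriorAlgebra.commute_ι_mul_ι_ι _ _ _).mul_right
      (ExteriorAlgebra.commute_ι_mul_ι_ι _ _ _)).smul_right _).smul_left _
  · simp only [List.mem_map]
    rintro _ ⟨i, -, rfl⟩
    rw [smul_mul_smul_comm, eBasis, eBasis, ExteriorAlgebra.ι_mul_ι_mul_self, smul_zero]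
end

section
/- Let n ≥ 1 and r ≥ 1 be integers and let m_1, …, m_r be integers. Then the least positive integer N with the property that for every subset S ⊆ {1, …, r}, n^{|S|} divides N · ∏_{i∈S} m_i, is equal to ∏_{i=1}^r (n / gcd(m_i, n)). -/
/-- If `n ^ |S|` divides `N * ∏ i ∈ S, m i` for every `S`, then so does the product of the reduced
denominators of the fractions `m i / n` divide `N`: at a prime `p`, test with the set of those `i`
for which `p` divides the reduced denominator. -/
theorem prod_div_gcd_dvd_of_forall_pow_card_dvd {ι : Type*} [Fintype ι] {n N : ℕ} (hn : 0 < n)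
    {m : ι → ℤ} (h : ∀ S : Finset ι, (n : ℤ) ^ S.card ∣ (N : ℤ) * ∏ i ∈ S, m i) :
    ∏ i, n / Int.gcd (m i) (n : ℤ) ∣ N := by
  classical
  have hg (i : ι) : 0 < Int.gcd (m i) n := Int.gcd_pos_of_ne_zero_right _ (by positivity)
  have hgn (i : ι) : Int.gcd (m i) n ∣ n := Int.natCast_dvd_natCast.mp (Int.gcd_dvd_right ..)
  have hgm (i : ι) : Int.gcd (m i) n ∣ (m i).natAbs := Int.gcd_dvd_natAbs_left ..
  have hcop (i : ι) :
      ((m i).natAbs / Int.gcd (m i) n).Coprime (n / Int.gcd (m i) n) :=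
    Nat.coprime_div_gcd_div_gcd (hg i)
  have hred (S : Finset ι) : ∏ i ∈ S, n / Int.gcd (m i) n ∣
      N * ∏ i ∈ S, (m i).natAbs / Int.gcd (m i) n := by
    have hS : n ^ S.card ∣ N * ∏ i ∈ S, (m i).natAbs := by
      have := Int.natAbs_dvd_natAbs.mpr (h S)
      rwa [Int.natAbs_mul, Int.natAbs_pow, Int.natAbs_natCast, Int.natAbs_natCast,
        ← Int.natAbsHom_apply (∏ i ∈ S, m i), map_prod] at this
    refine Nat.dvd_of_mul_dvd_mul_right (Finset.prod_pos fun i (_ : i ∈ S) => hg i) ?_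
    rw [mul_assoc, ← Finset.prod_mul_distrib, ← Finset.prod_mul_distrib]
    simpa only [Nat.div_mul_cancel (hgn _), Nat.div_mul_cancel (hgm _), Finset.prod_const] using hS
  refine (Nat.dvd_iff_prime_pow_dvd_dvd _ _).mpr fun p k hp hk => ?_
  rw [← Finset.prod_filter_mul_prod_filter_not Finset.univ
    (fun i => p ∣ n / Int.gcd (m i) n)] at hk
  have hdvd := (Nat.Coprime.dvd_of_dvd_mul_right (Nat.Coprime.pow_left k
    (Nat.Coprime.prod_right fun i hi =>
      hp.coprime_iff_not_dvd.mpr (Finset.mem_filter.mp hi).2)) hk).trans (hred _)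
  refine Nat.Coprime.dvd_of_dvd_mul_right (Nat.Coprime.pow_left k
    (Nat.Coprime.prod_right fun i hi => ?_)) hdvd
  exact (Nat.Coprime.coprime_dvd_right (Finset.mem_filter.mp hi).2 (hcop i)).symm

theorem least_integralizing_N (n r : ℕ) (hn : 1 ≤ n) (hr : 1 ≤ r) (m : Fin r → ℤ) :
    IsLeast {N : ℕ | 0 < N ∧ ∀ S : Finset (Fin r),
        (n : ℤ) ^ S.card ∣ (N : ℤ) * ∏ i ∈ S, m i}
      (∏ i : Fin r, n / Int.gcd (m i) (n : ℤ)) := by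
  refine ⟨⟨Finset.prod_pos fun i _ => ?_, fun S => ?_⟩, fun N ⟨hN, h⟩ =>
    Nat.le_of_dvd hN (prod_div_gcd_dvd_of_forall_pow_card_dvd hn h)⟩
  · exact Nat.div_pos (Nat.le_of_dvd hn (Int.natCast_dvd_natCast.mp (Int.gcd_dvd_right ..)))
      (Int.gcd_pos_of_ne_zero_right _ (by positivity))
  · have hsub : ((∏ i ∈ S, n / Int.gcd (m i) n : ℕ) : ℤ) ∣ (∏ i, n / Int.gcd (m i) n : ℕ) :=
      Int.natCast_dvd_natCast.mpr
        (Finset.prod_dvd_prod_of_subset _ _ _ (Finset.subset_univ S))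
    refine Dvd.dvd.trans ?_ (mul_dvd_mul_right hsub _)
    rw [Nat.cast_prod, ← Finset.prod_mul_distrib, ← Finset.prod_const]
    refine Finset.prod_dvd_prod_of_dvd _ _ fun i _ => ?_
    obtain ⟨a, ha⟩ : (Int.gcd (m i) n : ℤ) ∣ m i := Int.gcd_dvd_left ..
    have hq : ((n / Int.gcd (m i) n : ℕ) : ℤ) * (Int.gcd (m i) n : ℤ) = n := by
      exact_mod_cast Nat.div_mul_cancel (Int.natCast_dvd_natCast.mp (Int.gcd_dvd_right ..))
    exact ⟨a, by rw [← hq, mul_assoc, ← ha, hq]⟩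
end

section
/- Let n ≥ 1 and r ≥ 1 be integers, let m_1, …, m_r be integers, and let N be a positive integer such that for every subset S ⊆ {1, …, r}, n^{|S|} divides N · ∏_{i∈S} m_i. Then ∏_{i=1}^r (n / gcd(m_i, n)) divides N. -/
/-- If `n ^ #t ∣ N * ∏ i ∈ t, m i` for every `t ⊆ s`, then the same holds on `s` with each `m i`
replaced by `gcd (m i) n`: expand the product of the Bézout expressions for the gcds. -/
theorem Int.pow_card_dvd_mul_prod_gcd {ι : Type*} (s : Finset ι) (n N : ℤ) (m : ι → ℤ)
    (h : ∀ t ⊆ s, n ^ t.card ∣ N * ∏ i ∈ t, m i) :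
    n ^ s.card ∣ N * ∏ i ∈ s, (Int.gcd (m i) n : ℤ) := by
  classical
  simp_rw [Int.gcd_eq_gcd_ab, Finset.prod_add, Finset.mul_sum]
  refine Finset.dvd_sum fun t ht => ?_
  rw [Finset.mem_powerset] at ht
  simp_rw [Finset.prod_mul_distrib, Finset.prod_const]
  rw [← Finset.card_sdiff_add_card_eq_card ht, pow_add, mul_comm (n ^ _) (n ^ _), ← mul_assoc N,
    ← mul_assoc N]
  exact mul_dvd_mul ((h t ht).mul_right _) (dvd_mul_right _ _)

theorem prod_orders_divides_integralizing (n r : ℕ) (hn : 1 ≤ n) (hr : 1 ≤ r)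
    (m : Fin r → ℤ) (N : ℕ) (hN : 0 < N)
    (h : ∀ S : Finset (Fin r), (n : ℤ) ^ S.card ∣ (N : ℤ) * ∏ i ∈ S, m i) :
    (∏ i : Fin r, n / Int.gcd (m i) (n : ℤ)) ∣ N := by
  have gcd_dvd (i : Fin r) : Int.gcd (m i) n ∣ n :=
    Int.natCast_dvd_natCast.mp (Int.gcd_dvd_right _ _)
  have prod_gcd_pos : 0 < ∏ i, Int.gcd (m i) n :=
    Finset.prod_pos fun i _ => Nat.pos_of_dvd_of_pos (gcd_dvd i) hn
  have pow_dvd : n ^ r ∣ N * ∏ i, Int.gcd (m i) n := by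
    have := Int.pow_card_dvd_mul_prod_gcd Finset.univ n N m fun t _ => h t
    rw [Finset.card_univ, Fintype.card_fin] at this
    exact_mod_cast this
  refine Nat.dvd_of_mul_dvd_mul_right prod_gcd_pos ?_
  rw [← Finset.prod_mul_distrib]
  simpa [Nat.div_mul_cancel (gcd_dvd _)] using pow_dvd
end

section
/- Let g ≥ 1, n ≥ 1, 1 ≤ r ≤ g, and let a_1, …, a_r be integers. Let e_1, …, e_{2g} denote the images in the exterior algebra Λ(ℤ^{2g}) of the standard basis of ℤ^{2g}, and set η = ∑_{i=1}^r a_i · (e_i ∧ e_{i+g}) ∈ Λ²(ℤ^{2g}). Let f : ℤ^{2g} → ℤ^{2g} be an injective ℤ-linear map with finite cokernel of cardinality d. If the image (Λ²f)(η) of η under the induced map on the second exterior power lies in n·Λ²(ℤ^{2g}), then n^r divides d · ∏_{i=1}^r a_i. -/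
/-- The image in the exterior algebra `Λ(ℤ^{2g})` of the `j`-th standard basis
vector of `ℤ^{2g}`. -/
noncomputable def eZ (g : ℕ) (j : Fin (2 * g)) :
    ExteriorAlgebra ℤ (Fin (2 * g) → ℤ) :=
  ExteriorAlgebra.ι ℤ (Pi.single j 1)

open Matrix in
/-- If the alternating form `∑ i, c i • (x i ∧ y i)`, where the `x i` and `y i` are the columns
of a square matrix `F`, is divisible by `n`, then `n ^ card ι` divides `det F * ∏ i, c i`. -/
theorem pow_card_dvd_det_mul_prod {ι : Type*} [Fintype ι] [DecidableEq ι]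
    (F : Matrix (ι ⊕ ι) (ι ⊕ ι) ℤ) (c : ι → ℤ) (n : ℤ)
    (h : ∀ p q, n ∣ ∑ i, c i * (F p (.inl i) * F q (.inr i) - F q (.inl i) * F p (.inr i))) :
    n ^ Fintype.card ι ∣ F.det * ∏ i, c i := by
  choose B hB using h
  have hK : F * fromBlocks (diagonal c) 0 0 (diagonal c) * J ι ℤ * Fᵀ = n • (-Matrix.of B) := by
    ext p q
    simp only [J, mul_assoc, fromBlocks_multiply]
    simp only [Matrix.mul_apply, fromBlocks, Fintype.sum_sum_type]
    simp [← hB, Matrix.diagonal_apply]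
    rw [neg_add_eq_sub, ← Finset.sum_sub_distrib, ← Finset.sum_neg_distrib]
    exact Finset.sum_congr rfl fun i _ => by ring
  have hdet := congrArg det hK
  rw [det_smul, det_mul, det_mul, det_mul, det_transpose, det_fromBlocks_zero₂₁, det_diagonal,
    Fintype.card_sum] at hdet
  have hJ := J_det_mul_J_det ι ℤ
  rw [← Int.pow_dvd_pow_iff two_ne_zero, ← pow_mul, mul_two]
  refine ⟨(-Matrix.of B).det * (J ι ℤ).det, ?_⟩
  linear_combination (J ι ℤ).det * hdet - (F.det * ∏ i, c i) ^ 2 * hJ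

/-- The functional on the exterior algebra picking out the `(p, q)` coefficient in degree two. -/
noncomputable def exteriorAlgebraCoeff {κ : Type*} (p q : κ) :
    ExteriorAlgebra ℤ (κ → ℤ) →ₗ[ℤ] ℤ :=
  ExteriorAlgebra.liftAlternating fun i =>
    if h : i = 2 then
      (Matrix.detRowAlternating.compLinearMap
        (LinearMap.funLeft ℤ ℤ ![p, q])).domDomCongr (finCongr h.symm)
    else 0

theorem exteriorAlgebraCoeff_ι_mul_ι {κ : Type*} (p q : κ) (x y : κ → ℤ) :
    exteriorAlgebraCoeff p q (ExteriorAlgebra.ι ℤ x * ExteriorAlgebra.ι ℤ y) =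
      x p * y q - x q * y p := by
  have h := ExteriorAlgebra.ιMulti_apply (R := ℤ) ![x, y]
  simp only [List.ofFn_succ, List.ofFn_zero, List.prod_cons, List.prod_nil, mul_one] at h
  change _ = ExteriorAlgebra.ι ℤ x * ExteriorAlgebra.ι ℤ y at h
  rw [← h, exteriorAlgebraCoeff, ExteriorAlgebra.liftAlternating_apply_ιMulti]
  exact (Matrix.det_fin_two _).trans (by simp [LinearMap.funLeft])

theorem natCard_quotient_range_eq_natAbs_det {M : Type*} [AddCommGroup M] [Module.Free ℤ M]
    [Module.Finite ℤ M] (f : M →ₗ[ℤ] M) (hf : Function.Injective f) :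
    Nat.card (M ⧸ LinearMap.range f) = (LinearMap.det f).natAbs := by
  rw [← Submodule.natAbs_det_equiv _ (LinearEquiv.ofInjective f hf)]
  rfl

theorem isogeny_divisibility (g n r : ℕ) (hg : 1 ≤ g) (hn : 1 ≤ n) (hr1 : 1 ≤ r)
    (hr : r ≤ g) (a : Fin r → ℤ)
    (f : (Fin (2 * g) → ℤ) →ₗ[ℤ] (Fin (2 * g) → ℤ)) (hf : Function.Injective f)
    (d : ℕ) (hd : 0 < d)
    (hcard : Nat.card ((Fin (2 * g) → ℤ) ⧸ LinearMap.range f) = d)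
    (hdiv : ∃ ζ ∈ ⋀[ℤ]^2 (Fin (2 * g) → ℤ),
      ExteriorAlgebra.map f
          (∑ i : Fin r, a i • (eZ g (idxL hr i) * eZ g (idxH hr i))) = (n : ℤ) • ζ) :
    (n : ℤ) ^ r ∣ (d : ℤ) * ∏ i : Fin r, a i := by
  obtain ⟨ζ, -, hζ⟩ := hdiv
  obtain ⟨k, rfl⟩ := Nat.exists_eq_add_of_le hr
  let e : Fin (r + k) ⊕ Fin (r + k) ≃ Fin (2 * (r + k)) :=
    finSumFinEquiv.trans (finCongr (two_mul _).symm)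
  have key := pow_card_dvd_det_mul_prod ((LinearMap.toMatrix' f).submatrix e e)
    (Fin.append a fun _ => (n : ℤ)) n fun p q => by
      have h := congrArg (exteriorAlgebraCoeff (e p) (e q)) hζ
      simp only [map_sum, map_smul, map_mul, eZ, ExteriorAlgebra.map_apply_ι,
        exteriorAlgebraCoeff_ι_mul_ι, smul_eq_mul] at h
      rw [Fin.sum_univ_add]
      refine dvd_add ?_ (Finset.dvd_sum fun i _ => by simp)
      convert Dvd.intro _ h.symm using 2 with i
      have hL : e (.inl (Fin.castAdd k i)) = idxL hr i := rfl
      have hH : e (.inr (Fin.castAdd k i)) = idxH hr i := by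
        ext; simp [e, idxH]
      rw [Fin.append_left, Matrix.submatrix_apply, Matrix.submatrix_apply,
        Matrix.submatrix_apply, Matrix.submatrix_apply, hL, hH]
      simp [LinearMap.toMatrix'_apply]
  rw [Matrix.det_submatrix_equiv_self, LinearMap.det_toMatrix', Fin.prod_univ_add,
    Fintype.card_fin, pow_add] at key
  simp only [Fin.append_left, Fin.append_right, Finset.prod_const, Finset.card_univ,
    Fintype.card_fin, ← mul_assoc] at key
  have hn0 : (n : ℤ) ^ k ≠ 0 := by positivity
  rw [← hcard, natCard_quotient_range_eq_natAbs_det f hf, ← Int.dvd_natAbs, Int.natAbs_mul,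
    Int.natAbs_natCast, ← Int.natAbs_mul, Int.dvd_natAbs]
  exact Int.dvd_of_mul_dvd_mul_right hn0 key
end

section
/- Let g ≥ 1, n ≥ 1, 1 ≤ r ≤ g, and let m_1, …, m_r be nonzero integers. Let e_1, …, e_{2g} denote the images in the exterior algebra Λ(ℚ^{2g}) of the standard basis of ℚ^{2g}, set B = ∑_{i=1}^r (m_i/n) · (e_i ∧ e_{i+g}), and let exp(B) = ∑_{k=0}^{r} B^k/k! (the sum is finite since B^k = 0 for k > r). Let Λ(ℤ^{2g}) ⊆ Λ(ℚ^{2g}) denote the ℤ-subalgebra generated by e_1, …, e_{2g} (the standard integral lattice). Then the least positive integer N such that N · exp(B) ∈ Λ(ℤ^{2g}) is equal to ∏_{i=1}^r (n / gcd(m_i, n)). -/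
/-- The image in the exterior algebra `Λ(ℚ^{2g})` of the `j`-th standard basis
vector of `ℚ^{2g}`. -/
noncomputable def eQ (g : ℕ) (j : Fin (2 * g)) :
    ExteriorAlgebra ℚ (Fin (2 * g) → ℚ) :=
  ExteriorAlgebra.ι ℚ (Pi.single j 1)

/-- The rational `B`-field `B = ∑_{i=1}^r c_i · e_i ∧ e_{i+g}`. -/
noncomputable def Bfield {g r : ℕ} (hr : r ≤ g) (c : Fin r → ℚ) :
    ExteriorAlgebra ℚ (Fin (2 * g) → ℚ) :=
  ∑ i : Fin r, c i • (eQ g (idxL hr i) * eQ g (idxH hr i))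

/-- The wedge product `⋀_{i ∈ S} (e_i ∧ e_{i+g})`, taken in increasing order of the
indices in `S`. -/
noncomputable def wedgeProd {g r : ℕ} (hr : r ≤ g) (S : Finset (Fin r)) :
    ExteriorAlgebra ℚ (Fin (2 * g) → ℚ) :=
  ((S.sort (· ≤ ·)).map fun i => eQ g (idxL hr i) * eQ g (idxH hr i)).prod

/-- Contraction of `Λ(ℚ^{2g})` with the `k`-th coordinate functional. -/
noncomputable def coordContract {g : ℕ} (k : Fin (2 * g)) :
    ExteriorAlgebra ℚ (Fin (2 * g) → ℚ) →ₗ[ℚ] ExteriorAlgebra ℚ (Fin (2 * g) → ℚ) :=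
  CliffordAlgebra.contractLeft (Q := (0 : QuadraticForm ℚ (Fin (2 * g) → ℚ))) (LinearMap.proj k)

theorem coordContract_eQ_mul {g : ℕ} (k j : Fin (2 * g))
    (y : ExteriorAlgebra ℚ (Fin (2 * g) → ℚ)) :
    coordContract k (eQ g j * y) = (if k = j then y else 0) - eQ g j * coordContract k y := by
  refine (CliffordAlgebra.contractLeft_ι_mul (Q := (0 : QuadraticForm ℚ (Fin (2 * g) → ℚ)))
    (LinearMap.proj k) (Pi.single j 1) y).trans ?_
  congr 1
  by_cases h : k = j <;> simp [h]

theorem coordContract_one {g : ℕ} (k : Fin (2 * g)) : coordContract k 1 = 0 :=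
  CliffordAlgebra.contractLeft_one _ _

/-- The integral lattice is stable under contraction with coordinate functionals. -/
theorem coordContract_mem_adjoin {g : ℕ} (k : Fin (2 * g))
    {x : ExteriorAlgebra ℚ (Fin (2 * g) → ℚ)} (hx : x ∈ Algebra.adjoin ℤ (Set.range (eQ g))) :
    coordContract k x ∈ Algebra.adjoin ℤ (Set.range (eQ g)) := by
  suffices H : ∀ y ∈ Algebra.adjoin ℤ (Set.range (eQ g)),
      coordContract k y ∈ Algebra.adjoin ℤ (Set.range (eQ g)) →
      coordContract k (x * y) ∈ Algebra.adjoin ℤ (Set.range (eQ g)) by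
    simpa using H 1 (one_mem _) (by simp [coordContract_one])
  induction hx using Algebra.adjoin_induction with
  | mem x hx =>
    obtain ⟨j, rfl⟩ := hx
    intro y hy hky
    rw [coordContract_eQ_mul]
    refine sub_mem ?_ (mul_mem (Algebra.subset_adjoin ⟨j, rfl⟩) hky)
    split_ifs
    exacts [hy, zero_mem _]
  | algebraMap z =>
    intro y _ hky
    rw [← Algebra.smul_def, map_zsmul]
    exact zsmul_mem hky z
  | add x x' _ _ h h' =>
    intro y hy hky
    rw [add_mul, map_add]
    exact add_mem (h y hy hky) (h' y hy hky)
  | mul x x' _ hx' h h' =>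
    intro y hy hky
    rw [mul_assoc]
    exact h _ (mul_mem hx' hy) (h' y hy hky)

theorem algebraMapInv_mem_range_intCast {g : ℕ} {x : ExteriorAlgebra ℚ (Fin (2 * g) → ℚ)}
    (hx : x ∈ Algebra.adjoin ℤ (Set.range (eQ g))) :
    ∃ z : ℤ, ExteriorAlgebra.algebraMapInv x = (z : ℚ) := by
  induction hx using Algebra.adjoin_induction with
  | mem x hx =>
    obtain ⟨j, rfl⟩ := hx
    exact ⟨0, by simp [eQ, ExteriorAlgebra.algebraMapInv]⟩
  | algebraMap z => exact ⟨z, by simp⟩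
  | add x y _ _ hx hy =>
    obtain ⟨a, ha⟩ := hx
    obtain ⟨b, hb⟩ := hy
    exact ⟨a + b, by simp [ha, hb]⟩
  | mul x y _ _ hx hy =>
    obtain ⟨a, ha⟩ := hx
    obtain ⟨b, hb⟩ := hy
    exact ⟨a * b, by simp [ha, hb]⟩

theorem eQ_mul_self {g : ℕ} (j : Fin (2 * g)) : eQ g j * eQ g j = 0 :=
  ExteriorAlgebra.ι_sq_zero _

theorem eQ_mul_swap {g : ℕ} (j k : Fin (2 * g)) : eQ g j * eQ g k = -(eQ g k * eQ g j) :=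
  eq_neg_of_add_eq_zero_left (ExteriorAlgebra.ι_add_mul_swap _ _)

/-- The integral 2-form `e_i ∧ e_{i+g}`. -/
noncomputable def wedgePair {g r : ℕ} (hr : r ≤ g) (i : Fin r) :
    ExteriorAlgebra ℚ (Fin (2 * g) → ℚ) :=
  eQ g (idxL hr i) * eQ g (idxH hr i)

section wedgePair

variable {g r : ℕ} (hr : r ≤ g)

theorem wedgePair_mem_adjoin (i : Fin r) :
    wedgePair hr i ∈ Algebra.adjoin ℤ (Set.range (eQ g)) :=
  mul_mem (Algebra.subset_adjoin ⟨_, rfl⟩) (Algebra.subset_adjoin ⟨_, rfl⟩)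

theorem commute_wedgePair_eQ (i : Fin r) (j : Fin (2 * g)) :
    Commute (wedgePair hr i) (eQ g j) := by
  rw [commute_iff_eq, wedgePair, mul_assoc, eQ_mul_swap _ j, mul_neg, ← mul_assoc,
    eQ_mul_swap _ j, neg_mul, neg_neg, mul_assoc]

theorem commute_wedgePair (i j : Fin r) : Commute (wedgePair hr i) (wedgePair hr j) :=
  (commute_wedgePair_eQ hr i _).mul_right (commute_wedgePair_eQ hr i _)

theorem wedgePair_sq (i : Fin r) : wedgePair hr i ^ 2 = 0 := by
  rw [sq]
  nth_rw 2 [wedgePair]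
  rw [← mul_assoc, (commute_wedgePair_eQ hr i _).eq, wedgePair, ← mul_assoc, eQ_mul_self]
  simp

theorem smul_wedgePair_sq (a : ℚ) (i : Fin r) : (a • wedgePair hr i) ^ 2 = 0 := by
  rw [smul_pow, wedgePair_sq, smul_zero]

theorem commute_smul_wedgePair_sum (c : Fin r → ℚ) (i : Fin r) (T : Finset (Fin r)) :
    Commute (c i • wedgePair hr i) (∑ j ∈ T, c j • wedgePair hr j) :=
  Commute.sum_right _ _ _ fun j _ =>
    ((commute_wedgePair hr i j).smul_left _).smul_right _

theorem sum_smul_wedgePair_pow_eq_zero (c : Fin r → ℚ) (T : Finset (Fin r)) :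
    (∑ i ∈ T, c i • wedgePair hr i) ^ (T.card + 1) = 0 := by
  induction T using Finset.induction_on with
  | empty => simp
  | insert i T hi ih =>
    rw [Finset.sum_insert hi, Finset.card_insert_of_notMem hi]
    exact (commute_smul_wedgePair_sum hr c i T).add_pow_eq_zero_of_add_le_succ_of_pow_eq_zero
      (smul_wedgePair_sq hr (c i) i) ih (by omega)

/-- The exponential of the partial sum over `T` of a `B`-field. -/
noncomputable def expSum (c : Fin r → ℚ) (T : Finset (Fin r)) :
    ExteriorAlgebra ℚ (Fin (2 * g) → ℚ) :=
  IsNilpotent.exp (∑ i ∈ T, c i • wedgePair hr i)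

theorem expSum_empty (c : Fin r → ℚ) : expSum hr c ∅ = 1 := by
  simp [expSum, IsNilpotent.exp_zero]

theorem expSum_insert (c : Fin r → ℚ) {i : Fin r} {T : Finset (Fin r)} (hi : i ∉ T) :
    expSum hr c (insert i T) = expSum hr c T + c i • (wedgePair hr i * expSum hr c T) := by
  rw [expSum, Finset.sum_insert hi, IsNilpotent.exp_add_of_commute
    (commute_smul_wedgePair_sum hr c i T) ⟨2, smul_wedgePair_sq hr (c i) i⟩
    ⟨_, sum_smul_wedgePair_pow_eq_zero hr c T⟩,
    IsNilpotent.exp_eq_sum (smul_wedgePair_sq hr (c i) i), ← expSum]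
  simp [Finset.sum_range_succ, add_mul]

theorem coordContract_wedgePair_mul {k : Fin (2 * g)} {i : Fin r} (hL : k ≠ idxL hr i)
    (hH : k ≠ idxH hr i) (y : ExteriorAlgebra ℚ (Fin (2 * g) → ℚ)) :
    coordContract k (wedgePair hr i * y) = wedgePair hr i * coordContract k y := by
  simp [wedgePair, mul_assoc, coordContract_eQ_mul, hL, hH]

theorem coordContract_expSum (c : Fin r → ℚ) {k : Fin (2 * g)} {T : Finset (Fin r)}
    (hk : ∀ i ∈ T, k ≠ idxL hr i ∧ k ≠ idxH hr i) : coordContract k (expSum hr c T) = 0 := by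
  induction T using Finset.induction_on with
  | empty => rw [expSum_empty, coordContract_one]
  | insert i T hi ih =>
    have hki := hk i (Finset.mem_insert_self i T)
    rw [expSum_insert hr c hi, map_add, map_smul, coordContract_wedgePair_mul hr hki.1 hki.2,
      ih fun j hj => hk j (Finset.mem_insert_of_mem hj)]
    simp

theorem coordContract_idxL_expSum (c : Fin r → ℚ) {i : Fin r} {T : Finset (Fin r)} (hi : i ∉ T) :
    coordContract (idxL hr i) (expSum hr c T) = 0 :=
  coordContract_expSum hr c fun j hj => by
    have hij : i.1 ≠ j.1 := fun h => hi (Fin.ext h ▸ hj)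
    have := i.2
    simp only [idxL, idxH, ne_eq, Fin.mk.injEq]
    omega

theorem coordContract_idxH_expSum (c : Fin r → ℚ) {i : Fin r} {T : Finset (Fin r)} (hi : i ∉ T) :
    coordContract (idxH hr i) (expSum hr c T) = 0 :=
  coordContract_expSum hr c fun j hj => by
    have hij : i.1 ≠ j.1 := fun h => hi (Fin.ext h ▸ hj)
    have := j.2
    simp only [idxL, idxH, ne_eq, Fin.mk.injEq]
    omega

theorem coordContract_coordContract_expSum_insert (c : Fin r → ℚ) {i : Fin r}
    {T : Finset (Fin r)} (hi : i ∉ T) :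
    coordContract (idxH hr i) (coordContract (idxL hr i) (expSum hr c (insert i T))) =
      c i • expSum hr c T := by
  have hLH : idxL hr i ≠ idxH hr i := by
    have := i.2
    simp only [idxL, idxH, ne_eq, Fin.mk.injEq]
    omega
  simp [expSum_insert hr c hi, wedgePair, mul_assoc, coordContract_eQ_mul, hLH,
    coordContract_idxL_expSum hr c hi, coordContract_idxH_expSum hr c hi]

theorem prod_den_smul_expSum_mem_adjoin (c : Fin r → ℚ) (T : Finset (Fin r)) :
    (∏ i ∈ T, ((c i).den : ℚ)) • expSum hr c T ∈ Algebra.adjoin ℤ (Set.range (eQ g)) := by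
  induction T using Finset.induction_on with
  | empty => simp [expSum_empty]
  | insert i T hi ih =>
    have h : (∏ j ∈ insert i T, ((c j).den : ℚ)) • expSum hr c (insert i T) =
        (c i).den • ((∏ j ∈ T, ((c j).den : ℚ)) • expSum hr c T) +
        (c i).num • (wedgePair hr i * ((∏ j ∈ T, ((c j).den : ℚ)) • expSum hr c T)) := by
      rw [Finset.prod_insert hi, expSum_insert hr c hi, ← Nat.cast_smul_eq_nsmul ℚ,
        ← Int.cast_smul_eq_zsmul ℚ, ← Rat.den_mul_eq_num (c i), mul_smul_comm]
      module
    rw [h]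
    exact add_mem (nsmul_mem ih _) (zsmul_mem (mul_mem (wedgePair_mem_adjoin hr i) ih) _)

theorem eq_intCast_mul_prod_den_of_smul_expSum_mem_adjoin (c : Fin r → ℚ) (T : Finset (Fin r))
    {a : ℚ} (ha : a • expSum hr c T ∈ Algebra.adjoin ℤ (Set.range (eQ g))) :
    ∃ z : ℤ, a = z * ∏ i ∈ T, ((c i).den : ℚ) := by
  induction T using Finset.induction_on generalizing a with
  | empty =>
    obtain ⟨z, hz⟩ := algebraMapInv_mem_range_intCast ha
    exact ⟨z, by simpa [expSum_empty] using hz⟩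
  | insert i T hi ih =>
    have hc : (a * c i) • expSum hr c T ∈ Algebra.adjoin ℤ (Set.range (eQ g)) := by
      have h := coordContract_mem_adjoin (idxH hr i) (coordContract_mem_adjoin (idxL hr i) ha)
      rwa [map_smul, map_smul, coordContract_coordContract_expSum_insert hr c hi, smul_smul] at h
    have h1 : a • expSum hr c T ∈ Algebra.adjoin ℤ (Set.range (eQ g)) := by
      have h := sub_mem ha (mul_mem (wedgePair_mem_adjoin hr i) hc)
      rwa [expSum_insert hr c hi, smul_add, smul_smul, mul_smul_comm, add_sub_cancel_right] at h
    have hd : ((c i).den : ℚ) ≠ 0 := Nat.cast_ne_zero.2 (c i).den_ne_zero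
    obtain ⟨u, v, huv⟩ : IsCoprime ((c i).den : ℤ) (c i).num :=
      (Rat.isCoprime_num_den (c i)).symm
    have huv' : (u : ℚ) * (c i).den + v * ((c i).den * c i) = 1 := by
      rw [Rat.den_mul_eq_num]
      exact_mod_cast huv
    have hq : (a / (c i).den) • expSum hr c T ∈ Algebra.adjoin ℤ (Set.range (eQ g)) := by
      have h := add_mem (zsmul_mem h1 u) (zsmul_mem hc v)
      rw [← Int.cast_smul_eq_zsmul ℚ, ← Int.cast_smul_eq_zsmul ℚ, smul_smul, smul_smul,
        ← add_smul] at h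
      convert h using 2
      rw [div_eq_iff hd]
      linear_combination (-a) * huv'
    obtain ⟨z, hz⟩ := ih hq
    refine ⟨z, ?_⟩
    rw [Finset.prod_insert hi, mul_left_comm, ← hz, mul_div_cancel₀ _ hd]

theorem sum_Bfield_pow_eq_expSum (c : Fin r → ℚ) :
    ∑ k ∈ Finset.range (r + 1), (k.factorial : ℚ)⁻¹ • Bfield hr c ^ k =
      expSum hr c Finset.univ := by
  have h := sum_smul_wedgePair_pow_eq_zero hr c Finset.univ
  rw [Finset.card_fin] at h
  exact (IsNilpotent.exp_eq_sum h).symm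

end wedgePair

theorem Rat.den_intCast_div_natCast (m : ℤ) {n : ℕ} (hn : n ≠ 0) :
    ((m : ℚ) / n).den = n / Int.gcd m n := by
  have h := Rat.den_divInt m n
  rw [Rat.divInt_eq_div] at h
  simpa [hn, Int.gcd_comm] using h

theorem least_N_integral_exp_Bfield (g n r : ℕ) (hg : 1 ≤ g) (hn : 1 ≤ n)
    (hr1 : 1 ≤ r) (hr : r ≤ g) (m : Fin r → ℤ) (hm : ∀ i, m i ≠ 0) :
    IsLeast {N : ℕ | 0 < N ∧
        N • (∑ k ∈ Finset.range (r + 1),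
            (k.factorial : ℚ)⁻¹ • Bfield hr (fun i => (m i : ℚ) / n) ^ k) ∈
          Algebra.adjoin ℤ (Set.range (eQ g))}
      (∏ i : Fin r, n / Int.gcd (m i) (n : ℤ)) := by
  simp_rw [sum_Bfield_pow_eq_expSum, ← Nat.cast_smul_eq_nsmul ℚ,
    ← Rat.den_intCast_div_natCast _ (Nat.one_le_iff_ne_zero.1 hn)]
  refine ⟨⟨Finset.prod_pos fun i _ => Rat.den_pos _, ?_⟩, ?_⟩
  · rw [Nat.cast_prod]
    exact prod_den_smul_expSum_mem_adjoin hr _ _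
  · rintro N ⟨hN, hmem⟩
    obtain ⟨z, hz⟩ := eq_intCast_mul_prod_den_of_smul_expSum_mem_adjoin hr _ _ hmem
    refine Nat.le_of_dvd hN (Int.natCast_dvd_natCast.1 ⟨z, ?_⟩)
    rw [mul_comm]
    exact_mod_cast hz
end
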